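/- arXiv:1209.1368 — 11 statements merged into one kernel-verified Lean document; each statement's English description precedes it below -/
import Mathlib

section
/- Let M, Q, P be topological spaces, let π_Q : Q → M and π_P : P → M be principal circle structures, let n ≥ 1 be a natural number, and let φ₁, φ₂ : Q → P be fiberwise n-fold coverings. Then there exists a unique function f : M → Circle such that f(π_Q(q)) • φ₁(q) = φ₂(q) for all q ∈ Q. -/
open scoped unitInterval

/-- A principal circle structure on `E` over `M`: a continuous surjection `π : E → M`
together with a continuous `Circle`-action on `E` that preserves fibers and is
simply transitive on fibers. -/
structure IsPrincipalCircle {E M : Type*} [TopologicalSpace E] [TopologicalSpace M]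
    [MulAction Circle E] (π : E → M) : Prop where
  continuous_proj : Continuous π
  surjective_proj : Function.Surjective π
  continuous_smul : Continuous fun p : Circle × E => p.1 • p.2
  proj_smul : ∀ (z : Circle) (e : E), π (z • e) = π e
  existsUnique_smul : ∀ e e' : E, π e = π e' → ∃! z : Circle, z • e = e'

/-- A fiberwise `n`-fold covering between principal circle bundles. -/
structure IsFiberwiseCovering {M Q P : Type*} [TopologicalSpace M] [TopologicalSpace Q]
    [TopologicalSpace P] [MulAction Circle Q] [MulAction Circle P]
    (πQ : Q → M) (πP : P → M) (n : ℕ) (φ : Q → P) : Prop where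
  continuous : Continuous φ
  proj_comp : ∀ q : Q, πP (φ q) = πQ q
  smul_pow : ∀ (z : Circle) (q : Q), φ (z • q) = z ^ n • φ q

/-- Given two fiberwise `n`-fold coverings `φ₁, φ₂ : Q → P` of principal circle bundles
over `M`, there is a unique function `f : M → Circle` with
`f (πQ q) • φ₁ q = φ₂ q` for all `q`. -/
theorem existsUnique_horizontal_difference {M Q P : Type*} [TopologicalSpace M]
    [TopologicalSpace Q] [TopologicalSpace P] [MulAction Circle Q] [MulAction Circle P]
    {πQ : Q → M} {πP : P → M}
    (hQ : IsPrincipalCircle πQ) (hP : IsPrincipalCircle πP)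
    {n : ℕ} (hn : 1 ≤ n) {φ₁ φ₂ : Q → P}
    (h₁ : IsFiberwiseCovering πQ πP n φ₁) (h₂ : IsFiberwiseCovering πQ πP n φ₂) :
    ∃! f : M → Circle, ∀ q : Q, f (πQ q) • φ₁ q = φ₂ q := by
  choose s hs using hQ.surjective_proj
  choose d hd _ using fun q : Q =>
    hP.existsUnique_smul (φ₁ q) (φ₂ q) ((h₁.proj_comp q).trans (h₂.proj_comp q).symm)
  refine ⟨fun m => d (s m), fun q => ?_, fun g hg => funext fun m => ?_⟩
  · obtain ⟨z, hz, -⟩ := hQ.existsUnique_smul (s (πQ q)) q (hs (πQ q))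
    calc d (s (πQ q)) • φ₁ q = d (s (πQ q)) • z ^ n • φ₁ (s (πQ q)) := by
          rw [← h₁.smul_pow, hz]
      _ = z ^ n • d (s (πQ q)) • φ₁ (s (πQ q)) := by rw [smul_smul, mul_comm, mul_smul]
      _ = φ₂ q := by rw [hd, ← h₂.smul_pow, hz]
  · refine (hP.existsUnique_smul (φ₁ (s m)) (φ₂ (s m))
      ((h₁.proj_comp _).trans (h₂.proj_comp _).symm)).unique ?_ (hd (s m))
    simpa only [hs] using hg (s m)
end

section
/- Let M, Q, P be topological spaces, let π_Q : Q → M and π_P : P → M be principal circle structures, let n ≥ 1, and let φ₁, φ₂ : Q → P be fiberwise n-fold coverings. Suppose f : M → Circle is a continuous map with f(π_Q(q)) • φ₁(q) = φ₂(q) for all q ∈ Q, and suppose f is homotopic to the constant map with value 1. Then φ₁ and φ₂ are homotopic through fiberwise n-fold coverings; that is, there exists a continuous homotopy H : Q × [0,1] → P from φ₁ to φ₂ such that for every t ∈ [0,1] the map q ↦ H(q,t) is a fiberwise n-fold covering. -/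
open scoped unitInterval

/-- Two maps `φ₀, φ₁ : Q → P` are homotopic through fiberwise `n`-fold coverings if
there is a continuous homotopy from `φ₀` to `φ₁` all of whose time slices are
fiberwise `n`-fold coverings. -/
def HomotopicThroughFiberwiseCoverings {M Q P : Type*} [TopologicalSpace M]
    [TopologicalSpace Q] [TopologicalSpace P] [MulAction Circle Q] [MulAction Circle P]
    (πQ : Q → M) (πP : P → M) (n : ℕ) (φ₀ φ₁ : Q → P) : Prop :=
  ∃ H : C(Q × I, P),
    (∀ q : Q, H (q, 0) = φ₀ q) ∧ (∀ q : Q, H (q, 1) = φ₁ q) ∧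
    ∀ t : I, IsFiberwiseCovering πQ πP n fun q : Q => H (q, t)

/-- If the horizontal difference function `f` between two fiberwise `n`-fold coverings is
nullhomotopic, then the two coverings are homotopic through fiberwise coverings. -/
theorem homotopicThrough_of_nullhomotopic {M Q P : Type*} [TopologicalSpace M]
    [TopologicalSpace Q] [TopologicalSpace P] [MulAction Circle Q] [MulAction Circle P]
    {πQ : Q → M} {πP : P → M}
    (hQ : IsPrincipalCircle πQ) (hP : IsPrincipalCircle πP)
    {n : ℕ} (hn : 1 ≤ n) {φ₁ φ₂ : Q → P}
    (h₁ : IsFiberwiseCovering πQ πP n φ₁) (h₂ : IsFiberwiseCovering πQ πP n φ₂)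
    (f : M → Circle) (hf : Continuous f)
    (heq : ∀ q : Q, f (πQ q) • φ₁ q = φ₂ q)
    (hnull : ContinuousMap.Homotopic ⟨f, hf⟩ (ContinuousMap.const M 1)) :
    HomotopicThroughFiberwiseCoverings πQ πP n φ₁ φ₂ := by
  obtain ⟨F⟩ := hnull.symm
  have hcont : Continuous fun p : Q × I => F (p.2, πQ p.1) • φ₁ p.1 :=
    hP.continuous_smul.comp
      ((F.continuous.comp (continuous_snd.prodMk (hQ.continuous_proj.comp continuous_fst))).prodMk
        (h₁.continuous.comp continuous_fst))
  refine ⟨⟨_, hcont⟩, fun q => by simp, fun q => by simp [heq], fun t => ⟨?_, fun q => ?_,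
    fun z q => ?_⟩⟩
  · exact hcont.comp (continuous_id.prodMk continuous_const)
  · exact (hP.proj_smul _ _).trans (h₁.proj_comp q)
  · change F (t, πQ (z • q)) • φ₁ (z • q) = z ^ n • F (t, πQ q) • φ₁ q
    rw [hQ.proj_smul, h₁.smul_pow, smul_comm]
end

section
/- Let M, Q, P be topological spaces, let π_Q : Q → M and π_P : P → M be principal circle structures, and let n ≥ 1. Assume in addition that π_Q is a quotient map and that the division map of P is continuous, i.e. the map defined on the subspace {(y, y') ∈ P × P : π_P(y) = π_P(y')} sending (y, y') to the unique z ∈ Circle with z • y = y' is continuous. Let φ₁, φ₂ : Q → P be fiberwise n-fold coverings that are homotopic through fiberwise n-fold coverings (there is a continuous homotopy H : Q × [0,1] → P from φ₁ to φ₂ with each H(·,t) a fiberwise n-fold covering). Then the unique function f : M → Circle with f(π_Q(q)) • φ₁(q) = φ₂(q) for all q ∈ Q is continuous and homotopic to the constant map with value 1. -/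
open scoped unitInterval

/-- In a principal circle bundle, the action is free. -/
theorem IsPrincipalCircle.smul_left_injective {M P : Type*} [TopologicalSpace M]
    [TopologicalSpace P] [MulAction Circle P] {πP : P → M} (hP : IsPrincipalCircle πP) (e : P) :
    Function.Injective fun z : Circle => z • e := fun _ w h =>
  (hP.existsUnique_smul e (w • e) (hP.proj_smul w e).symm).unique h rfl

/-- A scalar relating two fiberwise `n`-fold coverings at one point of a fiber relates them at
every point of that fiber. -/
theorem IsFiberwiseCovering.smul_eq_of_proj_eq {M Q P : Type*} [TopologicalSpace M]
    [TopologicalSpace Q] [TopologicalSpace P] [MulAction Circle Q] [MulAction Circle P]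
    {πQ : Q → M} {πP : P → M} {n : ℕ} {φ ψ : Q → P} (hQ : IsPrincipalCircle πQ)
    (hφ : IsFiberwiseCovering πQ πP n φ) (hψ : IsFiberwiseCovering πQ πP n ψ)
    {w : Circle} {q q' : Q} (hq : πQ q = πQ q') (h : w • φ q = ψ q) : w • φ q' = ψ q' := by
  obtain ⟨z, rfl, -⟩ := hQ.existsUnique_smul q q' hq
  rw [hφ.smul_pow, hψ.smul_pow, ← h, smul_smul, smul_smul, mul_comm]

/-- If `πQ` is a quotient map and the division map of `P` is continuous, and the fiberwise
`n`-fold coverings `φ₁` and `φ₂` are homotopic through fiberwise coverings, then the unique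
function `f : M → Circle` with `f (πQ q) • φ₁ q = φ₂ q` for all `q` is continuous and
homotopic to the constant map with value `1`. -/
theorem nullhomotopic_of_homotopicThrough {M Q P : Type*} [TopologicalSpace M]
    [TopologicalSpace Q] [TopologicalSpace P] [MulAction Circle Q] [MulAction Circle P]
    {πQ : Q → M} {πP : P → M}
    (hQ : IsPrincipalCircle πQ) (hP : IsPrincipalCircle πP)
    (hquot : Topology.IsQuotientMap πQ)
    (hdiv : ∃ d : {y : P × P // πP y.1 = πP y.2} → Circle,
      Continuous d ∧ ∀ y : {y : P × P // πP y.1 = πP y.2}, d y • (y : P × P).1 = (y : P × P).2)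
    {n : ℕ} (hn : 1 ≤ n) {φ₁ φ₂ : Q → P}
    (h₁ : IsFiberwiseCovering πQ πP n φ₁) (h₂ : IsFiberwiseCovering πQ πP n φ₂)
    (hhom : HomotopicThroughFiberwiseCoverings πQ πP n φ₁ φ₂) :
    ∀ f : M → Circle, (∀ q : Q, f (πQ q) • φ₁ q = φ₂ q) →
      ∃ hf : Continuous f, ContinuousMap.Homotopic ⟨f, hf⟩ (ContinuousMap.const M 1) := by
  intro f hf
  obtain ⟨d, hd, hdsmul⟩ := hdiv
  obtain ⟨H, H0, H1, Hcov⟩ := hhom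
  have hproj (p : Q × I) : πP (φ₁ p.1) = πP (H p) :=
    (h₁.proj_comp p.1).trans ((Hcov p.2).proj_comp p.1).symm
  let g : Q × I → Circle := fun p => d ⟨(φ₁ p.1, H p), hproj p⟩
  have hg : Continuous g := hd.comp <| Continuous.subtype_mk
    ((h₁.continuous.comp continuous_fst).prodMk H.continuous) hproj
  have hgsmul (p : Q × I) : g p • φ₁ p.1 = H p := hdsmul ⟨(φ₁ p.1, H p), hproj p⟩
  let s : M → Q := Function.surjInv hQ.surjective_proj
  have hs (m : M) : πQ (s m) = m := Function.surjInv_eq hQ.surjective_proj m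
  let F : M × I → Circle := fun p => g (s p.1, p.2)
  have hFg (q : Q) (t : I) : F (πQ q, t) = g (q, t) := by
    apply hP.smul_left_injective (φ₁ q)
    exact (h₁.smul_eq_of_proj_eq hQ (Hcov t) (hs (πQ q)) (hgsmul (s (πQ q), t))).trans
      (hgsmul (q, t)).symm
  have hF : Continuous F := hquot.continuous_lift_prod_left (by simpa only [hFg] using hg)
  have hF0 (m : M) : F (m, 0) = 1 := by
    apply hP.smul_left_injective (φ₁ (s m))
    exact (hgsmul (s m, 0)).trans ((H0 _).trans (one_smul _ _).symm)
  have hF1 (m : M) : F (m, 1) = f m := by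
    apply hP.smul_left_injective (φ₁ (s m))
    have hfm := hf (s m)
    rw [hs] at hfm
    exact (hgsmul (s m, 1)).trans ((H1 _).trans hfm.symm)
  have hfc : Continuous f := by
    simpa only [Function.comp_def, hF1] using hF.comp (Continuous.prodMk_left (1 : I))
  refine ⟨hfc, ContinuousMap.Homotopic.symm ⟨?_⟩⟩
  exact
    { toFun := fun p => F (p.2, p.1)
      continuous_toFun := hF.comp continuous_swap
      map_zero_left := hF0
      map_one_left := hF1 }
end

section
/- Let M be a topological space, n ≥ 1, and let c₁, c₂ : M → Circle be continuous. For i = 1, 2 define the fiberwise n-fold covering φᵢ : M × Circle → M × Circle by φᵢ(p, θ) = (p, cᵢ(p) * θ^n). Then φ₁ and φ₂ are homotopic through fiberwise n-fold coverings if and only if the continuous map p ↦ c₂(p) * c₁(p)⁻¹ is homotopic to the constant map with value 1. -/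
open scoped unitInterval

/-- A fiberwise `n`-fold covering of the trivial circle bundle over `M`:
a continuous map commuting with the projection to `M` and intertwining the circle action
with its `n`-th power. -/
def IsTrivFiberwiseCovering {M : Type*} [TopologicalSpace M] (n : ℕ)
    (φ : M × Circle → M × Circle) : Prop :=
  Continuous φ ∧ (∀ (p : M) (θ : Circle), (φ (p, θ)).1 = p) ∧
    ∀ (p : M) (z θ : Circle), (φ (p, z * θ)).2 = z ^ n * (φ (p, θ)).2

/-- Homotopy through fiberwise `n`-fold coverings of the trivial circle bundle:
a continuous homotopy all of whose time slices are fiberwise `n`-fold coverings. -/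
def HomotopicThroughTrivCoverings {M : Type*} [TopologicalSpace M] (n : ℕ)
    (φ₀ φ₁ : M × Circle → M × Circle) : Prop :=
  ∃ H : C((M × Circle) × I, M × Circle),
    (∀ x : M × Circle, H (x, 0) = φ₀ x) ∧ (∀ x : M × Circle, H (x, 1) = φ₁ x) ∧
    ∀ t : I, IsTrivFiberwiseCovering n fun x : M × Circle => H (x, t)

/-- Two fiberwise `n`-fold coverings `φᵢ (p, θ) = (p, cᵢ p * θ ^ n)` of the trivial circle
bundle are homotopic through fiberwise `n`-fold coverings if and only if
`p ↦ c₂ p * (c₁ p)⁻¹` is nullhomotopic. -/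
theorem homotopicThroughTriv_iff_quotient_nullhomotopic {M : Type*} [TopologicalSpace M]
    (n : ℕ) (hn : 1 ≤ n) (c₁ c₂ : M → Circle) (hc₁ : Continuous c₁) (hc₂ : Continuous c₂) :
    HomotopicThroughTrivCoverings n
        (fun x : M × Circle => (x.1, c₁ x.1 * x.2 ^ n))
        (fun x : M × Circle => (x.1, c₂ x.1 * x.2 ^ n)) ↔
      ContinuousMap.Homotopic ⟨fun p : M => c₂ p * (c₁ p)⁻¹, hc₂.mul hc₁.inv⟩
        (ContinuousMap.const M 1) := by
  constructor
  · rintro ⟨H, h0, h1, -⟩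
    refine ContinuousMap.Homotopic.symm ⟨⟨⟨fun y => (H ((y.2, 1), y.1)).2 * (c₁ y.2)⁻¹, ?_⟩, ?_, ?_⟩⟩
    · fun_prop
    · intro p
      simp [h0]
    · intro p
      simp [h1]
  · intro h
    obtain ⟨G⟩ := h.symm
    refine ⟨⟨fun y => (y.1.1, G (y.2, y.1.1) * c₁ y.1.1 * y.1.2 ^ n), ?_⟩, ?_, ?_, ?_⟩
    · fun_prop
    · intro x
      simp
    · intro x
      simp
    · intro t
      refine ⟨?_, fun p θ => rfl, fun p z θ => ?_⟩
      · simp only [ContinuousMap.coe_mk]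
        fun_prop
      · simp only [ContinuousMap.coe_mk, mul_pow]
        exact mul_left_comm _ _ _
end

section
/- Let M be a topological space, n ≥ 1, and let f, g : M → Circle be continuous. Define fiberwise n-fold coverings φ_f, φ_g : M × Circle → M × Circle by φ_f(p, θ) = (p, f(p) * θ^n) and φ_g(p, θ) = (p, g(p) * θ^n). Then φ_f and φ_g are homotopic through fiberwise n-fold coverings if and only if f and g are homotopic as continuous maps M → Circle. -/
open scoped unitInterval

/-- The fiberwise `n`-fold coverings `φ_f (p, θ) = (p, f p * θ ^ n)` and
`φ_g (p, θ) = (p, g p * θ ^ n)` of the trivial circle bundle are homotopic through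
fiberwise `n`-fold coverings if and only if `f` and `g` are homotopic as continuous maps
`M → Circle`. -/
theorem homotopicThroughTriv_iff_homotopic {M : Type*} [TopologicalSpace M]
    (n : ℕ) (hn : 1 ≤ n) (f g : M → Circle) (hf : Continuous f) (hg : Continuous g) :
    HomotopicThroughTrivCoverings n
        (fun x : M × Circle => (x.1, f x.1 * x.2 ^ n))
        (fun x : M × Circle => (x.1, g x.1 * x.2 ^ n)) ↔
      ContinuousMap.Homotopic ⟨f, hf⟩ ⟨g, hg⟩ := by
  constructor
  · rintro ⟨H, h0, h1, -⟩
    exact ⟨{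
      toFun := fun x => (H ((x.2, 1), x.1)).2
      continuous_toFun := by fun_prop
      map_zero_left := fun p => by simp [h0]
      map_one_left := fun p => by simp [h1] }⟩
  · rintro ⟨F⟩
    refine ⟨⟨fun x => (x.1.1, F (x.2, x.1.1) * x.1.2 ^ n), by fun_prop⟩,
      fun x => by simp, fun x => by simp, fun t => ⟨by simp only [ContinuousMap.coe_mk]; fun_prop,
        fun p θ => rfl, fun p z θ => ?_⟩⟩
    simp only [ContinuousMap.coe_mk, mul_pow]
    exact mul_left_comm _ _ _
end

section
/- Let M be a topological space, n ≥ 1, and let c₁, c₂ : M → Circle be continuous. Then the following are equivalent: (a) there exists a continuous map ψ₂ : M → Circle such that c₂(p) = c₁(p) * (ψ₂(p))^n for all p ∈ M (equivalently, the fiberwise n-fold coverings φᵢ(p, θ) = (p, cᵢ(p) * θ^n) satisfy φ₂ = φ₁ ∘ ψ for the bundle automorphism ψ(p, θ) = (p, ψ₂(p) * θ), i.e. φ₁ and φ₂ are isomorphic as fiberwise coverings); (b) there exists a continuous map g : M → Circle such that the map p ↦ c₂(p) * c₁(p)⁻¹ is homotopic to the map p ↦ (g(p))^n. -/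
open scoped unitInterval

/-- Homotopic circle-valued maps differ by the exponential of a real-valued map. -/
theorem ContinuousMap.Homotopic.exists_eq_mul_circleExp {A : Type*} [TopologicalSpace A]
    {f₀ f₁ : C(A, Circle)} (h : f₀.Homotopic f₁) :
    ∃ r : C(A, ℝ), ∀ a, f₁ a = f₀ a * Circle.exp (r a) := by
  obtain ⟨F⟩ := h
  let G : C(I × A, Circle) := ⟨fun x => (f₀ x.2)⁻¹ * F x, by fun_prop⟩
  have hG : ∀ a, G (0, a) = Circle.exp ((0 : C(A, ℝ)) a) := by simp [G]
  let L := Circle.isCoveringMap_exp.liftHomotopy G 0 hG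
  refine ⟨⟨fun a => L (1, a), by fun_prop⟩, fun a => ?_⟩
  have hL : Circle.exp (L (1, a)) = G (1, a) :=
    congrFun (Circle.isCoveringMap_exp.liftHomotopy_lifts G 0 hG) (1, a)
  simp [hL, G]

/-- Two fiberwise `n`-fold coverings `φᵢ (p, θ) = (p, cᵢ p * θ ^ n)` of the trivial circle
bundle are isomorphic as fiberwise coverings — i.e. `c₂ = c₁ * ψ₂ ^ n` for some continuous
`ψ₂ : M → Circle` — if and only if `p ↦ c₂ p * (c₁ p)⁻¹` is homotopic to an `n`-th power. -/
theorem isomorphic_iff_quotient_homotopic_to_nth_power {M : Type*} [TopologicalSpace M]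
    (n : ℕ) (hn : 1 ≤ n) (c₁ c₂ : M → Circle) (hc₁ : Continuous c₁) (hc₂ : Continuous c₂) :
    (∃ ψ₂ : M → Circle, Continuous ψ₂ ∧ ∀ p : M, c₂ p = c₁ p * (ψ₂ p) ^ n) ↔
       ∃ g : M → Circle, ∃ hg : Continuous g,
        ContinuousMap.Homotopic ⟨fun p : M => c₂ p * (c₁ p)⁻¹, hc₂.mul hc₁.inv⟩
          ⟨fun p : M => (g p) ^ n, hg.pow n⟩ := by
  constructor
  · rintro ⟨ψ, hψ, h⟩
    refine ⟨ψ, hψ, ?_⟩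
    convert ContinuousMap.Homotopic.refl _ using 1
    ext1 p
    simp [h p]
  · rintro ⟨g, hg, h⟩
    obtain ⟨r, hr⟩ := h.exists_eq_mul_circleExp
    refine ⟨fun p => g p * (Circle.exp (r p / n))⁻¹, by fun_prop, fun p => ?_⟩
    have hn' : (n : ℝ) ≠ 0 := by positivity
    have hexp : Circle.exp (r p / n) ^ n = Circle.exp (r p) := by
      rw [← Circle.exp_natCast_mul, mul_div_cancel₀ _ hn']
    have hp : g p ^ n = c₂ p * (c₁ p)⁻¹ * Circle.exp (r p) := hr p
    rw [mul_pow, inv_pow, hexp, hp, mul_inv_cancel_right, mul_comm, inv_mul_cancel_right]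
end

section
/- Let M be a topological space and let f : M → Circle be a continuous map that is homotopic to the constant map with value 1. Then for every natural number n ≥ 1 there exists a continuous map g : M → Circle such that f(p) = (g(p))^n for all p ∈ M. -/
/-- A nullhomotopic map to the circle factors through `Circle.exp`. -/
theorem ContinuousMap.Homotopic.exists_circleExp_lift {M : Type*} [TopologicalSpace M]
    {f : C(M, Circle)} (hf : f.Homotopic (ContinuousMap.const M 1)) :
    ∃ θ : C(M, ℝ), ∀ p, Circle.exp (θ p) = f p := by
  obtain ⟨H⟩ := hf.symm
  have H_zero : ∀ a, H.toContinuousMap (0, a) = Circle.exp (ContinuousMap.const M (0 : ℝ) a) :=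
    fun a ↦ by simp
  let L := Circle.isCoveringMap_exp.liftHomotopy H.toContinuousMap (.const M 0) H_zero
  refine ⟨L.comp ((ContinuousMap.const M 1).prodMk (.id M)), fun p ↦ ?_⟩
  exact (congr_fun (Circle.isCoveringMap_exp.liftHomotopy_lifts _ _ H_zero) (1, p)).trans
    (H.apply_one p)

/-- A continuous map `M → Circle` that is homotopic to the constant map with value `1`
admits a continuous `n`-th root for every `n ≥ 1`. -/
theorem exists_nth_root_of_nullhomotopic {M : Type*} [TopologicalSpace M]
    (f : M → Circle) (hf : Continuous f)
    (hnull : ContinuousMap.Homotopic ⟨f, hf⟩ (ContinuousMap.const M 1)) :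
    ∀ n : ℕ, 1 ≤ n → ∃ g : M → Circle, Continuous g ∧ ∀ p : M, f p = (g p) ^ n := by
  intro n hn
  obtain ⟨θ, hθ⟩ := hnull.exists_circleExp_lift
  refine ⟨fun p ↦ Circle.exp (θ p / n), by fun_prop, fun p ↦ ?_⟩
  have hn' : (n : ℝ) ≠ 0 := by positivity
  rw [← Circle.exp_nsmul, nsmul_eq_mul, mul_div_cancel₀ _ hn']
  exact (hθ p).symm
end

section
/- Fix n ≥ 1. For α ∈ ℤ define φ_α : Circle × Circle → Circle × Circle by φ_α(p, θ) = (p, p^α * θ^n); this is a fiberwise n-fold covering of the trivial circle bundle over Circle. For α, β ∈ ℤ, the maps φ_α and φ_β are homotopic through fiberwise n-fold coverings if and only if α = β. -/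
open scoped unitInterval

theorem Circle.eq_of_exp_comp_const {X : Type*} [TopologicalSpace X] [PreconnectedSpace X]
    {f : X → ℝ} (hf : Continuous f) (hexp : ∀ x y, Circle.exp (f x) = Circle.exp (f y))
    (x y : X) : f x = f y :=
  congrFun (Circle.isCoveringMap_exp.eq_of_comp_eq hf continuous_const
    (funext fun z => hexp z y) y rfl) x

/-- The degree of a power map of the circle is a homotopy invariant. -/
theorem Circle.eq_of_zpow_homotopic {g : Circle × I → Circle} (hg : Continuous g) {α β : ℤ}
    (h₀ : ∀ p, g (p, 0) = p ^ α) (h₁ : ∀ p, g (p, 1) = p ^ β) : α = β := by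
  let f : C(ℝ × ℝ, Circle) :=
    ⟨fun x => g (Circle.exp x.1, Set.projIcc 0 1 zero_le_one x.2),
      hg.comp ((Circle.exp.continuous.comp continuous_fst).prodMk
        (continuous_projIcc.comp continuous_snd))⟩
  obtain ⟨e, he⟩ := Circle.exp_surjective (f 0)
  obtain ⟨F, ⟨-, hF⟩, -⟩ := Circle.isCoveringMap_exp.existsUnique_continuousMap_lifts f 0 e he
  have lift (s t : ℝ) : Circle.exp (F (s, t)) =
      g (Circle.exp s, Set.projIcc 0 1 zero_le_one t) := congrFun hF (s, t)
  have monodromy (t : ℝ) (γ : ℤ) (ht : ∀ p, g (p, Set.projIcc 0 1 zero_le_one t) = p ^ γ) :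
      F (2 * Real.pi, t) - F (0, t) = γ * (2 * Real.pi) := by
    have h := Circle.eq_of_exp_comp_const (f := fun s : ℝ => F (s, t) - γ * s)
      (by fun_prop) (fun x y => by simp [lift, ht]) (2 * Real.pi) 0
    simp only [mul_zero] at h
    linarith
  have h := Circle.eq_of_exp_comp_const
    (f := fun t : ℝ => F (2 * Real.pi, t) - F (0, t)) (by fun_prop)
    (fun x y => by simp [lift]) 0 1
  rw [monodromy 0 α (by simpa using h₀), monodromy 1 β (by simpa using h₁)] at h
  exact_mod_cast mul_right_cancel₀ Real.two_pi_pos.ne' h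

/-- Over the base `Circle`, the maps `φ_α (p, θ) = (p, p ^ α * θ ^ n)` for `α : ℤ` are
fiberwise `n`-fold coverings of the trivial circle bundle, and `φ_α` and `φ_β` are
homotopic through fiberwise `n`-fold coverings if and only if `α = β`. -/
theorem trivCoverings_over_circle_classified_by_int (n : ℕ) (hn : 1 ≤ n) :
    (∀ α : ℤ, IsTrivFiberwiseCovering n
      (fun x : Circle × Circle => (x.1, x.1 ^ α * x.2 ^ n))) ∧
    ∀ α β : ℤ,
      (HomotopicThroughTrivCoverings n
        (fun x : Circle × Circle => (x.1, x.1 ^ α * x.2 ^ n))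
        (fun x : Circle × Circle => (x.1, x.1 ^ β * x.2 ^ n)) ↔ α = β) := by
  have covering (α : ℤ) : IsTrivFiberwiseCovering n
      (fun x : Circle × Circle => (x.1, x.1 ^ α * x.2 ^ n)) :=
    ⟨by fun_prop, fun _ _ => rfl, fun p z θ => by
      simp only [mul_pow]
      exact mul_left_comm _ _ _⟩
  refine ⟨covering, fun α β => ⟨?_, ?_⟩⟩
  · rintro ⟨H, h₀, h₁, -⟩
    exact Circle.eq_of_zpow_homotopic (g := fun x => (H ((x.1, 1), x.2)).2) (by fun_prop)
      (fun p => by simp [h₀]) (fun p => by simp [h₁])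
  · rintro rfl
    exact ⟨⟨fun x => (x.1.1, x.1.1 ^ α * x.1.2 ^ n), by fun_prop⟩,
      fun _ => rfl, fun _ => rfl, fun _ => covering α⟩
end

section
/- Fix n ≥ 1. Every fiberwise n-fold covering φ of the trivial circle bundle over Circle is homotopic through fiberwise n-fold coverings to φ_α for some α ∈ ℤ, where φ_α(p, θ) = (p, p^α * θ^n). -/
open scoped unitInterval

/-- A continuous self-map `g` of the circle has the form `p ↦ p ^ α * exp (u p)`, where `α` is its
degree and `u` is a continuous real function. -/
theorem Circle.exists_eq_zpow_mul_exp (g : C(Circle, Circle)) :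
    ∃ (α : ℤ) (u : C(Circle, ℝ)), ∀ p, g p = p ^ α * Circle.exp (u p) := by
  obtain ⟨e₀, he₀⟩ := Circle.exp_surjective (g (Circle.exp 0))
  obtain ⟨G, ⟨-, hG⟩, -⟩ := Circle.isCoveringMap_exp.existsUnique_continuousMap_lifts
    (g.comp Circle.exp) 0 e₀ he₀
  replace hG (t : ℝ) : Circle.exp (G t) = g (Circle.exp t) := congr_fun hG t
  obtain ⟨α, hα⟩ : ∃ α : ℤ, G (0 + 2 * Real.pi) = G 0 + α * (2 * Real.pi) :=
    Circle.exp_eq_exp.mp (by rw [hG, hG, Circle.exp_add_two_pi])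
  have hstep (t : ℝ) : G (t + 2 * Real.pi) = G t + α * (2 * Real.pi) := by
    refine congr_fun (Circle.isCoveringMap_exp.eq_of_comp_eq
      (g₁ := fun t => G (t + 2 * Real.pi)) (g₂ := fun t => G t + α * (2 * Real.pi))
      (by fun_prop) (by fun_prop) (funext fun t => ?_) 0 hα) t
    simp [hG, Circle.exp_add]
  have hquot : Topology.IsQuotientMap Circle.exp :=
    Circle.isCoveringMap_exp.isQuotientMap Circle.exp_surjective
  let v : C(ℝ, ℝ) := ⟨fun t => G t - α * t, by fun_prop⟩
  have hv : Function.Periodic v (2 * Real.pi) := fun t => by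
    simp only [v, ContinuousMap.coe_mk, hstep]
    ring
  have hfactor : Function.FactorsThrough v Circle.exp := fun s t hst => by
    obtain ⟨m, rfl⟩ := Circle.exp_eq_exp.mp hst
    exact hv.int_mul m t
  refine ⟨α, hquot.lift (f := Circle.exp) v hfactor, fun p => ?_⟩
  obtain ⟨t, rfl⟩ := Circle.exp_surjective p
  have hlift : hquot.lift (f := Circle.exp) v hfactor (Circle.exp t) = v t :=
    DFunLike.congr_fun (hquot.lift_comp v hfactor) t
  rw [hlift, ← hG, ← Circle.exp_zsmul, ← Circle.exp_add]
  simp [v]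

/-- Every fiberwise `n`-fold covering of the trivial circle bundle over `Circle` is
homotopic through fiberwise `n`-fold coverings to `φ_α (p, θ) = (p, p ^ α * θ ^ n)`
for some `α : ℤ`. -/
theorem trivCovering_over_circle_homotopic_to_standard (n : ℕ) (hn : 1 ≤ n)
    (φ : Circle × Circle → Circle × Circle) (hφ : IsTrivFiberwiseCovering n φ) :
    ∃ α : ℤ, HomotopicThroughTrivCoverings n φ
      (fun x : Circle × Circle => (x.1, x.1 ^ α * x.2 ^ n)) := by
  obtain ⟨hcont, hfst, hsnd⟩ := hφ
  obtain ⟨α, u, hu⟩ := Circle.exists_eq_zpow_mul_exp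
    ⟨fun p => (φ (p, 1)).2, by fun_prop⟩
  refine ⟨α, ⟨fun x => (x.1.1, x.1.1 ^ α * Circle.exp ((1 - x.2) * u x.1.1) * x.1.2 ^ n),
    by fun_prop⟩, ?_, ?_, fun t => ⟨by fun_prop, fun _ _ => rfl, fun p z θ => ?_⟩⟩
  · rintro ⟨p, θ⟩
    refine Prod.ext (hfst p θ).symm ?_
    have h := hsnd p θ 1
    have hp := hu p
    simp only [ContinuousMap.coe_mk] at hp
    rw [mul_one, hp] at h
    simp [h, mul_comm]
  · simp
  · simp only [ContinuousMap.coe_mk, mul_pow]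
    exact mul_left_comm _ _ _
end

section
/- Fix n ≥ 1 and let T³ = Circle × Circle × Circle. For α = (α₁, α₂, α₃) ∈ ℤ³ define φ_α : T³ × Circle → T³ × Circle by φ_α((p₁, p₂, p₃), θ) = ((p₁, p₂, p₃), p₁^{α₁} * p₂^{α₂} * p₃^{α₃} * θ^n); this is a fiberwise n-fold covering of the trivial circle bundle over T³. For α, β ∈ ℤ³, the maps φ_α and φ_β are homotopic through fiberwise n-fold coverings if and only if α = β. -/
open scoped unitInterval

/-- A homotopy of self-maps of the circle preserves the exponent of a power map. -/
theorem Circle.eq_of_homotopy_zpow {a b : ℤ} {K : I × Circle → Circle} (hK : Continuous K)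
    (h₀ : ∀ p, K (0, p) = p ^ a) (h₁ : ∀ p, K (1, p) = p ^ b) : a = b := by
  let G : C(I × ℝ, Circle) := ⟨fun y => K (y.1, Circle.exp y.2), by fun_prop⟩
  let f : C(ℝ, ℝ) := ⟨fun x => a * x, by fun_prop⟩
  have hG : ∀ x, G (0, x) = Circle.exp (f x) := fun x => by
    simp [G, f, h₀, Circle.exp_intCast_mul]
  let F := Circle.isCoveringMap_exp.liftHomotopy G f hG
  have exp_F (s : I) (x : ℝ) : Circle.exp (F (s, x)) = K (s, Circle.exp x) :=
    congrFun (Circle.isCoveringMap_exp.liftHomotopy_lifts G f hG) (s, x)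
  have F_zero (x : ℝ) : F (0, x) = a * x :=
    Circle.isCoveringMap_exp.liftHomotopy_zero G f hG x
  have degree_const : F (0, 2 * Real.pi) - F (0, 0) = F (1, 2 * Real.pi) - F (1, 0) :=
    Circle.isCoveringMap_exp.const_of_comp
      (g := fun s : I => F (s, 2 * Real.pi) - F (s, 0)) (by fun_prop)
      (fun s t => by simp [Circle.exp_sub, exp_F]) 0 1
  have F_one : F (1, 2 * Real.pi) - b * (2 * Real.pi) = F (1, 0) - b * 0 :=
    Circle.isCoveringMap_exp.const_of_comp
      (g := fun x : ℝ => F (1, x) - b * x) (by fun_prop)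
      (fun x y => by simp [Circle.exp_sub, exp_F, h₁, Circle.exp_intCast_mul]) _ _
  have key : (a : ℝ) * (2 * Real.pi) = b * (2 * Real.pi) := by
    rw [F_zero, F_zero] at degree_const
    linarith
  exact_mod_cast mul_right_cancel₀ Real.two_pi_pos.ne' key

/-- Homotopic fiberwise coverings over `M` have homotopic restrictions along any loop `γ` in `M`;
in particular their exponents along `γ` agree. -/
theorem HomotopicThroughTrivCoverings.exponent_eq {M : Type*} [TopologicalSpace M] {n : ℕ}
    {φ₀ φ₁ : M × Circle → M × Circle} (h : HomotopicThroughTrivCoverings n φ₀ φ₁)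
    {γ : Circle → M} (hγ : Continuous γ) {a b : ℤ}
    (h₀ : ∀ p, (φ₀ (γ p, 1)).2 = p ^ a) (h₁ : ∀ p, (φ₁ (γ p, 1)).2 = p ^ b) : a = b := by
  obtain ⟨H, hH₀, hH₁, -⟩ := h
  exact Circle.eq_of_homotopy_zpow (K := fun y => (H ((γ y.2, 1), y.1)).2) (by fun_prop)
    (fun p => by rw [hH₀, h₀]) (fun p => by rw [hH₁, h₁])

/-- A fiberwise covering is homotopic to itself through fiberwise coverings. -/
theorem IsTrivFiberwiseCovering.homotopic_refl {M : Type*} [TopologicalSpace M] {n : ℕ}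
    {φ : M × Circle → M × Circle} (h : IsTrivFiberwiseCovering n φ) :
    HomotopicThroughTrivCoverings n φ φ :=
  ⟨⟨fun y => φ y.1, h.1.comp continuous_fst⟩, fun _ => rfl, fun _ => rfl, fun _ => h⟩

/-- Over the base `T³ = Circle × Circle × Circle`, the maps
`φ_α ((p₁, p₂, p₃), θ) = ((p₁, p₂, p₃), p₁ ^ α₁ * p₂ ^ α₂ * p₃ ^ α₃ * θ ^ n)` for
`α = (α₁, α₂, α₃) : ℤ × ℤ × ℤ` are fiberwise `n`-fold coverings of the trivial circle
bundle, and `φ_α` and `φ_β` are homotopic through fiberwise `n`-fold coverings if and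
only if `α = β`. -/
theorem trivCoverings_over_threeTorus_classified_by_int3 (n : ℕ) (hn : 1 ≤ n) :
    (∀ α : ℤ × ℤ × ℤ, IsTrivFiberwiseCovering n
      (fun x : (Circle × Circle × Circle) × Circle =>
        (x.1, x.1.1 ^ α.1 * x.1.2.1 ^ α.2.1 * x.1.2.2 ^ α.2.2 * x.2 ^ n))) ∧
    ∀ α β : ℤ × ℤ × ℤ,
      (HomotopicThroughTrivCoverings n
        (fun x : (Circle × Circle × Circle) × Circle =>
          (x.1, x.1.1 ^ α.1 * x.1.2.1 ^ α.2.1 * x.1.2.2 ^ α.2.2 * x.2 ^ n))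
        (fun x : (Circle × Circle × Circle) × Circle =>
          (x.1, x.1.1 ^ β.1 * x.1.2.1 ^ β.2.1 * x.1.2.2 ^ β.2.2 * x.2 ^ n)) ↔ α = β) := by
  have covering (α : ℤ × ℤ × ℤ) : IsTrivFiberwiseCovering n
      (fun x : (Circle × Circle × Circle) × Circle =>
        (x.1, x.1.1 ^ α.1 * x.1.2.1 ^ α.2.1 * x.1.2.2 ^ α.2.2 * x.2 ^ n)) :=
    ⟨by fun_prop, fun _ _ => rfl, fun p z θ => by simp only [mul_pow]; ac_rfl⟩
  refine ⟨covering, fun α β => ⟨fun h => ?_, ?_⟩⟩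
  · refine Prod.ext ?_ (Prod.ext ?_ ?_)
    · exact h.exponent_eq (γ := fun p => (p, 1, 1)) (by fun_prop) (by simp) (by simp)
    · exact h.exponent_eq (γ := fun p => (1, p, 1)) (by fun_prop) (by simp) (by simp)
    · exact h.exponent_eq (γ := fun p => (1, 1, p)) (by fun_prop) (by simp) (by simp)
  · rintro rfl
    exact (covering α).homotopic_refl
end

section
/- Fix n ≥ 1 and let T³ = Circle × Circle × Circle. Every fiberwise n-fold covering φ of the trivial circle bundle over T³ is homotopic through fiberwise n-fold coverings to φ_α for some α = (α₁, α₂, α₃) ∈ ℤ³, where φ_α((p₁, p₂, p₃), θ) = ((p₁, p₂, p₃), p₁^{α₁} * p₂^{α₂} * p₃^{α₃} * θ^n). -/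
open scoped unitInterval

/-- Every continuous map from a simply connected, locally path-connected space to the circle
has a continuous logarithm. -/
theorem exists_continuousMap_circleExp_eq {X : Type*} [TopologicalSpace X]
    [SimplyConnectedSpace X] [LocallyPathConnectedSpace X] (f : C(X, Circle)) :
    ∃ g : C(X, ℝ), ∀ x, Circle.exp (g x) = f x := by
  obtain ⟨x₀⟩ : Nonempty X := inferInstance
  obtain ⟨g, ⟨-, hg⟩, -⟩ := Circle.isCoveringMap_exp.existsUnique_continuousMap_lifts f x₀
    (Complex.arg (f x₀)) (Circle.exp_arg _)
  exact ⟨g, congrFun hg⟩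

/-- Two continuous real functions on a connected space with the same exponential in the circle
differ by a constant integer multiple of `2 * π`. -/
theorem exists_int_forall_eq_add_of_circleExp_eq {X : Type*} [TopologicalSpace X]
    [ConnectedSpace X] {f g : X → ℝ} (hf : Continuous f) (hg : Continuous g)
    (h : ∀ x, Circle.exp (f x) = Circle.exp (g x)) :
    ∃ k : ℤ, ∀ x, f x = g x + k * (2 * Real.pi) := by
  obtain ⟨x₀⟩ : Nonempty X := inferInstance
  obtain ⟨k, hk⟩ := Circle.exp_eq_exp.mp (h x₀)
  refine ⟨k, fun x ↦ ?_⟩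
  have hconst : f x - g x = f x₀ - g x₀ :=
    Circle.isCoveringMap_exp.const_of_comp (g := fun x ↦ f x - g x) (hf.sub hg)
      (fun a b ↦ by simp [h]) x x₀
  linarith

/-- The exponential map to the circle turns finite sums into products. -/
theorem circleExp_sum {ι : Type*} (s : Finset ι) (f : ι → ℝ) :
    Circle.exp (∑ i ∈ s, f i) = ∏ i ∈ s, Circle.exp (f i) := by
  classical
  induction s using Finset.induction_on with
  | empty => simp
  | insert i s hi ih => rw [Finset.sum_insert hi, Finset.prod_insert hi, Circle.exp_add, ih]

/-- A continuous map from a torus to the circle is a character times the exponential of a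
continuous real function. -/
theorem exists_eq_circleExp_mul_prod_zpow {ι : Type*} [Fintype ι] (f : C(ι → Circle, Circle)) :
    ∃ (α : ι → ℤ) (h : C(ι → Circle, ℝ)), ∀ p, f p = Circle.exp (h p) * ∏ i, p i ^ α i := by
  classical
  let q : (ι → ℝ) → ι → Circle := Pi.map fun _ ↦ Circle.exp
  have hq : IsOpenQuotientMap q := .piMap fun _ ↦
    ⟨Circle.isAddQuotientCoveringMap_exp.surjective, Circle.exp.continuous,
      isLocalHomeomorph_circleExp.isOpenMap⟩
  obtain ⟨g, hg⟩ := exists_continuousMap_circleExp_eq (f.comp ⟨q, hq.continuous⟩)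
  let v (m : ι → ℤ) : ι → ℝ := fun i ↦ m i * (2 * Real.pi)
  have hqv (x : ι → ℝ) (m : ι → ℤ) : q (x + v m) = q x :=
    funext fun i ↦ Circle.exp_eq_exp.mpr ⟨m i, rfl⟩
  have hper (m : ι → ℤ) : ∃ k : ℤ, ∀ x, g (x + v m) = g x + k * (2 * Real.pi) :=
    exists_int_forall_eq_add_of_circleExp_eq (by fun_prop) (by fun_prop) fun x ↦ by
      simp [hg, hqv]
  choose k hk using hper
  have hk_add (m m' : ι → ℤ) : k (m + m') = k m + k m' := by
    have hv : v (m + m') = v m + v m' := by ext i; simp [v, add_mul]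
    have h := hk (m + m') 0
    rw [hv, ← add_assoc, hk, hk] at h
    have : ((k (m + m') : ℤ) : ℝ) = k m + k m' := by
      apply mul_right_cancel₀ Real.two_pi_pos.ne'
      linarith
    exact_mod_cast this
  let α (i : ι) : ℤ := k (Pi.single i 1)
  have hk_sum (m : ι → ℤ) : k m = ∑ i, m i * α i := by
    have h := (AddMonoidHom.mk' k hk_add).toIntLinearMap.pi_apply_eq_sum_univ m
    simp only [AddMonoidHom.coe_toIntLinearMap, AddMonoidHom.mk'_apply, smul_eq_mul] at h
    rw [h]
    refine Finset.sum_congr rfl fun i _ ↦ ?_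
    congr 2
    ext j
    simp [Pi.single_apply, eq_comm]
  let u : C(ι → ℝ, ℝ) := ⟨fun x ↦ g x - ∑ i, α i * x i, by fun_prop⟩
  have hu (x y : ι → ℝ) (hxy : q x = q y) : u x = u y := by
    choose m hm using fun i ↦ Circle.exp_eq_exp.mp (congrFun hxy i)
    obtain rfl : x = y + v m := funext hm
    simp only [u, ContinuousMap.coe_mk, hk, hk_sum, Pi.add_apply, v, mul_add,
      Finset.sum_add_distrib]
    push_cast
    rw [Finset.sum_mul]
    have : ∑ i, (m i * α i : ℝ) * (2 * Real.pi) = ∑ i, α i * (m i * (2 * Real.pi)) :=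
      Finset.sum_congr rfl fun i _ ↦ by ring
    linarith
  let h : C(ι → Circle, ℝ) := hq.isQuotientMap.lift (f := ⟨q, hq.continuous⟩) u hu
  have hh (x : ι → ℝ) : h (q x) = u x :=
    DFunLike.congr_fun (hq.isQuotientMap.lift_comp (f := ⟨q, hq.continuous⟩) u hu) x
  refine ⟨α, h, fun p ↦ ?_⟩
  obtain ⟨x, rfl⟩ := hq.surjective p
  have hsum : Circle.exp (∑ i, α i * x i) = ∏ i, q x i ^ α i := by
    simp [circleExp_sum, q]
  rw [hh, ← hsum, ← Circle.exp_add]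
  simp [u, hg]

/-- Multiplying the fiber coordinate by the exponential of a continuous real function does not
change the homotopy class of a fiberwise `n`-fold covering. -/
theorem IsTrivFiberwiseCovering.homotopicThroughTrivCoverings {M : Type*} [TopologicalSpace M]
    {n : ℕ} {φ : M × Circle → M × Circle} (hφ : IsTrivFiberwiseCovering n φ)
    (g : C(M, Circle)) (h : C(M, ℝ)) (hgh : ∀ p, (φ (p, 1)).2 = Circle.exp (h p) * g p) :
    HomotopicThroughTrivCoverings n φ fun x ↦ (x.1, g x.1 * x.2 ^ n) := by
  obtain ⟨-, hbase, hfiber⟩ := hφ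
  refine ⟨⟨fun x ↦ (x.1.1, Circle.exp ((1 - x.2) * h x.1.1) * g x.1.1 * x.1.2 ^ n), by fun_prop⟩,
    fun x ↦ ?_, fun x ↦ by simp, fun t ↦ ⟨by fun_prop, fun _ _ ↦ rfl, fun p z θ ↦ ?_⟩⟩
  · refine Prod.ext (hbase x.1 x.2).symm ?_
    have := hfiber x.1 x.2 1
    rw [mul_one] at this
    simp [this, hgh, mul_comm]
  · simp only [ContinuousMap.coe_mk, mul_pow]
    exact mul_left_comm _ _ _

/-- Every fiberwise `n`-fold covering of the trivial circle bundle over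
`T³ = Circle × Circle × Circle` is homotopic through fiberwise `n`-fold coverings to
`φ_α ((p₁, p₂, p₃), θ) = ((p₁, p₂, p₃), p₁ ^ α₁ * p₂ ^ α₂ * p₃ ^ α₃ * θ ^ n)` for some
`α = (α₁, α₂, α₃) : ℤ × ℤ × ℤ`. -/
theorem trivCovering_over_threeTorus_homotopic_to_standard (n : ℕ) (hn : 1 ≤ n)
    (φ : (Circle × Circle × Circle) × Circle → (Circle × Circle × Circle) × Circle)
    (hφ : IsTrivFiberwiseCovering n φ) :
    ∃ α : ℤ × ℤ × ℤ, HomotopicThroughTrivCoverings n φ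
      (fun x : (Circle × Circle × Circle) × Circle =>
        (x.1, x.1.1 ^ α.1 * x.1.2.1 ^ α.2.1 * x.1.2.2 ^ α.2.2 * x.2 ^ n)) := by
  let e : C(Fin 3 → Circle, Circle × Circle × Circle) :=
    ⟨fun p ↦ (p 0, p 1, p 2), by fun_prop⟩
  let e' : C(Circle × Circle × Circle, Fin 3 → Circle) :=
    ⟨fun p ↦ ![p.1, p.2.1, p.2.2], by fun_prop⟩
  let f : C(Circle × Circle × Circle, Circle) :=
    ⟨fun p ↦ (φ (p, 1)).2, (hφ.1.comp (by fun_prop)).snd⟩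
  obtain ⟨α, h, hα⟩ := exists_eq_circleExp_mul_prod_zpow (f.comp e)
  refine ⟨(α 0, α 1, α 2), hφ.homotopicThroughTrivCoverings
    ⟨fun p ↦ p.1 ^ α 0 * p.2.1 ^ α 1 * p.2.2 ^ α 2, by fun_prop⟩ (h.comp e') fun p ↦ ?_⟩
  simpa [f, e, e', Fin.prod_univ_three] using hα (e' p)
end
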